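/- Let I ⊆ ℝ be an interval and let F : I ⇒ ℝ be a set-valued function with F(x) ≠ ∅ for all x ∈ I. If F is locally monotone on I (i.e., every x ∈ I admits an open neighborhood U ⊆ ℝ such that the restriction of F to U ∩ I is monotone), then F is monotone on I. -/

import Mathlib

open Set Filter

/-- Quasimonotone set-valued function on a set `S ⊆ ℝ`. -/
def SVQuasimonotoneOn (F : ℝ → Set ℝ) (S : Set ℝ) : Prop :=
  ∀ x ∈ S, ∀ y ∈ S, ∀ xs ∈ F x, ∀ ys ∈ F y, xs * (y - x) > 0 → ys * (y - x) ≥ 0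

/-- Strictly quasimonotone set-valued function on a set `S ⊆ ℝ`. -/
def SVStrictlyQuasimonotoneOn (F : ℝ → Set ℝ) (S : Set ℝ) : Prop :=
  SVQuasimonotoneOn F S ∧
    ∀ x ∈ S, ∀ y ∈ S, x ≠ y →
      ∃ z ∈ openSegment ℝ x y, z ∈ S ∧ ∃ zs ∈ F z, zs * (y - x) ≠ 0

/-- Pseudomonotone set-valued function on a set `S ⊆ ℝ`. -/
def SVPseudomonotoneOn (F : ℝ → Set ℝ) (S : Set ℝ) : Prop :=
  ∀ x ∈ S, ∀ y ∈ S, ∀ xs ∈ F x, ∀ ys ∈ F y, xs * (y - x) ≥ 0 → ys * (y - x) ≥ 0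

/-- Strictly pseudomonotone set-valued function on a set `S ⊆ ℝ`. -/
def SVStrictlyPseudomonotoneOn (F : ℝ → Set ℝ) (S : Set ℝ) : Prop :=
  ∀ x ∈ S, ∀ y ∈ S, x ≠ y → ∀ xs ∈ F x, ∀ ys ∈ F y, xs * (y - x) ≥ 0 → ys * (y - x) > 0

/-- Monotone set-valued function on a set `S ⊆ ℝ`. -/
def SVMonotoneOn (F : ℝ → Set ℝ) (S : Set ℝ) : Prop :=
  ∀ x ∈ S, ∀ y ∈ S, ∀ xs ∈ F x, ∀ ys ∈ F y, (xs - ys) * (x - y) ≥ 0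

/-- Lower semicontinuity of a set-valued function on `I`. -/
def SVLscOn (F : ℝ → Set ℝ) (I : Set ℝ) : Prop :=
  ∀ x ∈ I, ∀ N : Set ℝ, IsOpen N → (F x ∩ N).Nonempty →
    ∃ M ∈ nhds x, ∀ y ∈ M ∩ I, (F y ∩ N).Nonempty

/-- Monotonicity of a set-valued function glues along a common point at which it is nonempty. -/
theorem SVMonotoneOn.union_of_le {F : ℝ → Set ℝ} {S T : Set ℝ} {c : ℝ}
    (hS : SVMonotoneOn F S) (hT : SVMonotoneOn F T) (hcS : c ∈ S) (hcT : c ∈ T)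
    (hSc : ∀ x ∈ S, x ≤ c) (hcT' : ∀ x ∈ T, c ≤ x) (hc : (F c).Nonempty) :
    SVMonotoneOn F (S ∪ T) := by
  obtain ⟨cs, hcs⟩ := hc
  have key : ∀ x ∈ S, ∀ y ∈ T, ∀ xs ∈ F x, ∀ ys ∈ F y, (xs - ys) * (x - y) ≥ 0 := by
    intro x hx y hy xs hxs ys hys
    rcases (hSc x hx).eq_or_lt with rfl | hxc
    · exact hT x hcT y hy xs hxs ys hys
    rcases (hcT' y hy).eq_or_lt with rfl | hcy
    · exact hS x hx c hcS xs hxs ys hys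
    have h₁ : xs ≤ cs := by nlinarith [hS x hx c hcS xs hxs cs hcs]
    have h₂ : cs ≤ ys := by nlinarith [hT c hcT y hy cs hcs ys hys]
    exact mul_nonneg_of_nonpos_of_nonpos (by linarith) (by linarith)
  rintro x (hx | hx) y (hy | hy) xs hxs ys hys
  · exact hS x hx y hy xs hxs ys hys
  · exact key x hx y hy xs hxs ys hys
  · linarith [key y hy x hx ys hys xs hxs]
  · exact hT x hx y hy xs hxs ys hys

theorem SVMonotoneOn.mono {F : ℝ → Set ℝ} {S T : Set ℝ} (hT : SVMonotoneOn F T) (h : S ⊆ T) :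
    SVMonotoneOn F S :=
  fun x hx y hy => hT x (h hx) y (h hy)

theorem SVMonotoneOn.uIcc_trans {F : ℝ → Set ℝ} {x y z : ℝ}
    (hxy : SVMonotoneOn F (uIcc x y)) (hyz : SVMonotoneOn F (uIcc y z)) (hy : (F y).Nonempty) :
    SVMonotoneOn F (uIcc x z) := by
  rcases le_total x y with h₁ | h₁ <;> rcases le_total y z with h₂ | h₂
  · refine (hxy.union_of_le hyz right_mem_uIcc left_mem_uIcc ?_ ?_ hy).mono
      uIcc_subset_uIcc_union_uIcc
    · rw [uIcc_of_le h₁]; exact fun _ h => h.2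
    · rw [uIcc_of_le h₂]; exact fun _ h => h.1
  · rcases le_total x z with h | h
    · exact hxy.mono (uIcc_subset_uIcc_left (mem_uIcc_of_le h h₂))
    · exact hyz.mono (uIcc_subset_uIcc_right (mem_uIcc_of_ge h h₁))
  · rcases le_total x z with h | h
    · exact hyz.mono (uIcc_subset_uIcc_right (mem_uIcc_of_le h₁ h))
    · exact hxy.mono (uIcc_subset_uIcc_left (mem_uIcc_of_ge h₂ h))
  · refine (hyz.union_of_le hxy left_mem_uIcc right_mem_uIcc ?_ ?_ hy).mono
      (uIcc_subset_uIcc_union_uIcc.trans (union_comm _ _).subset)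
    · rw [uIcc_of_ge h₂]; exact fun _ h => h.2
    · rw [uIcc_of_ge h₁]; exact fun _ h => h.1

/-- If a nonempty-valued set-valued function on an interval `I ⊆ ℝ` is locally monotone on `I`,
then it is monotone on `I`. -/
theorem locally_monotone_of_interval
    (I : Set ℝ) (hI : I.OrdConnected) (F : ℝ → Set ℝ)
    (hne : ∀ x ∈ I, (F x).Nonempty)
    (hloc : ∀ x ∈ I, ∃ U : Set ℝ, IsOpen U ∧ x ∈ U ∧ SVMonotoneOn F (U ∩ I)) :
    SVMonotoneOn F I := by
  intro x hx y hy
  refine hI.isPreconnected.induction₂' (fun a b => SVMonotoneOn F (uIcc a b)) (fun a ha => ?_)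
    (fun a b c _ hb _ hab hbc => hab.uIcc_trans hbc (hne b hb)) hx hy
    x left_mem_uIcc y right_mem_uIcc
  obtain ⟨U, hU, haU, hmono⟩ := hloc a ha
  obtain ⟨ε, hε, hball⟩ := Metric.isOpen_iff.mp hU a haU
  filter_upwards [mem_nhdsWithin_of_mem_nhds (Metric.ball_mem_nhds a hε), self_mem_nhdsWithin]
    with b hb hbI
  have hsub : uIcc a b ⊆ U ∩ I := subset_inter
    (((convex_ball a ε).ordConnected.uIcc_subset (Metric.mem_ball_self hε) hb).trans hball)
    (hI.uIcc_subset ha hbI)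
  exact ⟨hmono.mono hsub, hmono.mono (uIcc_comm b a ▸ hsub)⟩
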